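/- Let C ⊆ ℝⁿ be a cone based at y and Σ ⊆ ℝⁿ. Let x ∈ ℝⁿ and r, s > 0 satisfy B(y,s) ⊆ B(x,r) and B(y,s) ∩ Σ ≠ ∅. Then D^{y,s}(C,Σ) ≤ 2·(r/s)·D̃^{x,r}(C,Σ), and in particular D^{y,s}(C,Σ) ≤ 2·(r/s)·D^{x,r}(C,Σ). -/

import Mathlib

open Metric Set MeasureTheory Filter Module
open scoped RealInnerProductSpace Topology Pointwise ENNReal

noncomputable section

/-- `ℝⁿ` as a Euclidean space. -/
abbrev E (n : ℕ) : Type := EuclideanSpace ℝ (Fin n)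

/-- `d(A,B) = sup_{a ∈ A} inf_{b ∈ B} |a - b|`. -/
def setD {n : ℕ} (A B : Set (E n)) : ℝ := ⨆ a ∈ A, Metric.infDist a B

/-- `d^{x,r}(A,B) = (1/r) d(A ∩ B(x,r), B ∩ B(x,r))`. -/
def dxr {n : ℕ} (x : E n) (r : ℝ) (A B : Set (E n)) : ℝ :=
  (1 / r) * setD (A ∩ closedBall x r) (B ∩ closedBall x r)

/-- `D^{x,r}(A,B) = max(d^{x,r}(A,B), d^{x,r}(B,A))`. -/
def Dxr {n : ℕ} (x : E n) (r : ℝ) (A B : Set (E n)) : ℝ :=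
  max (dxr x r A B) (dxr x r B A)

/-- `d̃^{x,r}(A,B) = (1/r) d(A ∩ B(x,r), B)`. -/
def dtxr {n : ℕ} (x : E n) (r : ℝ) (A B : Set (E n)) : ℝ :=
  (1 / r) * setD (A ∩ closedBall x r) B

/-- `D̃^{x,r}(A,B) = max(d̃^{x,r}(A,B), d̃^{x,r}(B,A))`. -/
def Dtxr {n : ℕ} (x : E n) (r : ℝ) (A B : Set (E n)) : ℝ :=
  max (dtxr x r A B) (dtxr x r B A)

/-- `C` is a cone based at `y`: `y ∈ C` and `s • (C − y) = C − y` for all `s > 0`. -/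
def IsConeAt {n : ℕ} (y : E n) (C : Set (E n)) : Prop :=
  y ∈ C ∧ ∀ s : ℝ, 0 < s → s • {z : E n | y + z ∈ C} = {z : E n | y + z ∈ C}

/-- The standard KP cone `{x₄² = x₁² + x₂² + x₃²}` in `ℝⁿ`, `n ≥ 4`. -/
def stdKP (n : ℕ) (hn : 4 ≤ n) : Set (E n) :=
  {x : E n | (x ⟨3, by omega⟩) ^ 2 =
    (x ⟨0, by omega⟩) ^ 2 + (x ⟨1, by omega⟩) ^ 2 + (x ⟨2, by omega⟩) ^ 2}

/-- `C` is a KP cone based at `y`: in some orthonormal coordinates centered at the origin,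
`C − y` is the standard KP cone. -/
def IsKPCone {n : ℕ} (hn : 4 ≤ n) (y : E n) (C : Set (E n)) : Prop :=
  ∃ f : E n ≃ₗᵢ[ℝ] E n, {z : E n | y + z ∈ C} = f ⁻¹' stdKP n hn

/-- `θ^P_Σ(x,r)` : best approximation of `S` in `B(x,r)` by affine `m`-planes through `x`. -/
def thetaP {n : ℕ} (m : ℕ) (S : Set (E n)) (x : E n) (r : ℝ) : ℝ :=
  ⨅ L : {L : AffineSubspace ℝ (E n) // x ∈ L ∧ Module.finrank ℝ L.direction = m},
    Dxr x r S (L.1 : Set (E n))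

/-- `θ^C_Σ(x,r)` : best approximation of `S` in `B(x,r)` by KP cones based at `x`. -/
def thetaC {n : ℕ} (hn : 4 ≤ n) (S : Set (E n)) (x : E n) (r : ℝ) : ℝ :=
  ⨅ C : {C : Set (E n) // IsKPCone hn x C}, Dxr x r S C.1

/-- `ϑ^C_Σ(x,r)` : best approximation of `S` in `B(x,r)` by KP cones containing `x`. -/
def varthetaC {n : ℕ} (hn : 4 ≤ n) (S : Set (E n)) (x : E n) (r : ℝ) : ℝ :=
  ⨅ C : {C : Set (E n) // (∃ y, IsKPCone hn y C) ∧ x ∈ C}, Dxr x r S C.1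

/-- The angle `∠(P₁,P₂) = arcsin Γ(P₁,P₂)` between two affine planes. -/
def planeAngle {n : ℕ} (P₁ P₂ : AffineSubspace ℝ (E n)) : ℝ :=
  Real.arcsin (dxr (0 : E n) 1 (P₁.direction : Set (E n)) (P₂.direction : Set (E n)))

/-- The support of a measure. -/
def msupp {n : ℕ} (μ : Measure (E n)) : Set (E n) :=
  {x : E n | ∀ r : ℝ, 0 < r → 0 < μ (closedBall x r)}

/-- Weak convergence of a sequence of measures in the sense of Radon measures. -/
def VagueTendsto {n : ℕ} (μs : ℕ → Measure (E n)) (ν : Measure (E n)) : Prop :=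
  ∀ f : E n → ℝ, Continuous f → HasCompactSupport f →
    Tendsto (fun i => ∫ y, f y ∂(μs i)) atTop (nhds (∫ y, f y ∂ν))

/-- `ν` is a tangent measure of `μ` at `x`: `ν ≠ 0` and for some `rᵢ ↓ 0`, `cᵢ > 0`,
`cᵢ (T_{x,rᵢ})₊μ → ν` weakly. -/
def IsTangentMeasure {n : ℕ} (μ ν : Measure (E n)) (x : E n) : Prop :=
  ν ≠ 0 ∧ ∃ r c : ℕ → ℝ, (∀ i, 0 < r i) ∧ Tendsto r atTop (nhds 0) ∧ (∀ i, 0 < c i) ∧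
    VagueTendsto (fun i => ENNReal.ofReal (c i) • Measure.map (fun y => (r i)⁻¹ • (y - x)) μ) ν

/-- `μ` is `m`-asymptotically optimally doubling. -/
def AOD {n : ℕ} (m : ℕ) (μ : Measure (E n)) : Prop :=
  ∀ K : Set (E n), K ⊆ msupp μ → IsCompact K → ∀ δ : ℝ, 0 < δ →
    ∃ r₀ : ℝ, 0 < r₀ ∧ ∀ x ∈ K, ∀ r : ℝ, 0 < r → r ≤ r₀ →
      ∀ τ : ℝ, τ ∈ Set.Icc (1/2 : ℝ) 1 →
        |(μ (closedBall x (τ * r))).toReal / (μ (closedBall x r)).toReal - τ ^ m| < δ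

/-- `ν` is `m`-flat: `m`-dimensional Hausdorff measure restricted to an affine `m`-plane. -/
def IsFlatMeasure {n : ℕ} (m : ℕ) (ν : Measure (E n)) : Prop :=
  ∃ L : AffineSubspace ℝ (E n), (L : Set (E n)).Nonempty ∧
    Module.finrank ℝ L.direction = m ∧
    ν = (Measure.hausdorffMeasure (m : ℝ)).restrict (L : Set (E n))

/-- Volume of the unit ball in `ℝᵐ`. -/
def unitBallVol (m : ℕ) : ℝ := (volume (Metric.ball (0 : EuclideanSpace ℝ (Fin m)) 1)).toReal

/-- `ω₃`, the volume of the unit `3`-ball. -/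
def omega3 : ℝ := unitBallVol 3

/-- The second moment `Q_{0,r}` of a measure on `ℝ⁴`. -/
def Qmom (μ : Measure (E 4)) (r : ℝ) (z : E 4) : ℝ :=
  (5 / (omega3 * r ^ 5)) * ∫ w in closedBall (0 : E 4) r, ⟪z, w⟫ ^ 2 ∂μ

/-- Entries `q_{ij}` of the second moment matrix in given directions. -/
def qmom (μ : Measure (E 4)) (r : ℝ) (u v : E 4) : ℝ :=
  (5 / (omega3 * r ^ 5)) * ∫ w in closedBall (0 : E 4) r, ⟪u, w⟫ * ⟪v, w⟫ ∂μ

/-- `μ` is `(α,m)`-Hölder asymptotically uniform. -/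
def HolderAsympUniform {n : ℕ} (α : ℝ) (m : ℕ) (μ : Measure (E n)) : Prop :=
  ∀ K : Set (E n), K ⊆ msupp μ → IsCompact K →
    ∃ C r₀ : ℝ, 0 < r₀ ∧ ∀ x ∈ K, ∀ r : ℝ, 0 < r → r ≤ r₀ →
      |(μ (closedBall x r)).toReal / (unitBallVol m * r ^ m) - 1| ≤ C * r ^ α

/-- `φ` is a `C^{1,β}` diffeomorphism from `U` onto `U'`: a continuously differentiable bijection
with `β`-Hölder derivative whose inverse is also `C^{1,β}`. -/
def IsC1HolderDiffeoOn (β : ℝ) (U U' : Set (E 4)) (φ : E 4 → E 4) : Prop :=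
  Set.BijOn φ U U' ∧
  (∀ x ∈ U, HasFDerivAt φ (fderiv ℝ φ x) x) ∧
  (∃ M : ℝ, ∀ x ∈ U, ∀ y ∈ U, ‖fderiv ℝ φ x - fderiv ℝ φ y‖ ≤ M * ‖x - y‖ ^ β) ∧
  ∃ ψ : E 4 → E 4, Set.BijOn ψ U' U ∧
    (∀ x ∈ U, ψ (φ x) = x) ∧ (∀ y ∈ U', φ (ψ y) = y) ∧
    (∀ y ∈ U', HasFDerivAt ψ (fderiv ℝ ψ y) y) ∧
    (∃ M : ℝ, ∀ x ∈ U', ∀ y ∈ U', ‖fderiv ℝ ψ x - fderiv ℝ ψ y‖ ≤ M * ‖x - y‖ ^ β)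

theorem aux_setD_le {n : ℕ} {A B : Set (E n)} {M : ℝ} (hM : 0 ≤ M)
    (h : ∀ a ∈ A, Metric.infDist a B ≤ M) : setD A B ≤ M :=
  Real.iSup_le (fun a => Real.iSup_le (fun ha => h a ha) hM) hM

theorem aux_setD_nonneg {n : ℕ} (A B : Set (E n)) : 0 ≤ setD A B :=
  Real.iSup_nonneg (fun _ => Real.iSup_nonneg (fun _ => Metric.infDist_nonneg))

theorem aux_le_setD {n : ℕ} {A B : Set (E n)} {x : E n} {r : ℝ} (hr : 0 < r)
    (hA : A ⊆ closedBall x r) (hB : B.Nonempty) {a : E n} (ha : a ∈ A) :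
    Metric.infDist a B ≤ setD A B := by
  obtain ⟨b, hb⟩ := hB
  have key : ∀ a ∈ A, Metric.infDist a B ≤ r + dist x b := fun a ha =>
    (Metric.infDist_le_dist_of_mem hb).trans
      ((dist_triangle a x b).trans (by have := mem_closedBall.1 (hA ha); linarith))
  have h0 : (0 : ℝ) ≤ r + dist x b := by positivity
  have hbdd : BddAbove (range fun a => ⨆ _ : a ∈ A, Metric.infDist a B) := by
    refine ⟨r + dist x b, ?_⟩
    rintro _ ⟨a, rfl⟩
    exact Real.iSup_le (fun ha => key a ha) h0
  have h1 := le_ciSup hbdd a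
  simp only [ha, ciSup_unique] at h1
  exact h1

theorem aux_cone {n : ℕ} {y : E n} {C : Set (E n)} (hC : IsConeAt y C) {c : E n} (hc : c ∈ C)
    {t : ℝ} (ht : 0 ≤ t) : y + t • (c - y) ∈ C := by
  rcases ht.eq_or_lt with rfl | ht
  · simpa using hC.1
  · have h : t • (c - y) ∈ t • {z : E n | y + z ∈ C} :=
      Set.smul_mem_smul_set (by simpa using hc)
    rw [hC.2 t ht] at h
    exact h

theorem aux_main {n : ℕ} (y : E n) (C S : Set (E n))
    (hC : IsConeAt y C) (s ε : ℝ) (hs : 0 < s) (hε : 0 ≤ ε)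
    (hne : (S ∩ closedBall y s).Nonempty)
    (h1 : ∀ c ∈ C ∩ closedBall y s, Metric.infDist c S ≤ ε)
    (h2 : ∀ p ∈ S ∩ closedBall y s, Metric.infDist p C ≤ ε) :
    (∀ c ∈ C ∩ closedBall y s, Metric.infDist c (S ∩ closedBall y s) ≤ 2 * ε) ∧
    (∀ p ∈ S ∩ closedBall y s, Metric.infDist p (C ∩ closedBall y s) ≤ 2 * ε) := by
  have hSne : S.Nonempty := hne.mono inter_subset_left
  constructor
  · rintro c ⟨hc, hcs⟩
    rw [mem_closedBall] at hcs
    rcases le_or_gt s ε with hse | hse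
    · obtain ⟨p, hp⟩ := hne
      have h3 := mem_closedBall'.1 hp.2
      have := Metric.infDist_le_dist_of_mem (x := c) hp
      have := dist_triangle c y p
      linarith
    · have key : ∀ e, ε < e → e ≤ s → Metric.infDist c (S ∩ closedBall y s) ≤ 2 * e := by
        intro e he hes
        obtain ⟨c', hc', hd1, hd2⟩ : ∃ c' ∈ C, dist c c' ≤ e ∧ dist c' y + e ≤ s := by
          rcases le_or_gt (dist c y) e with h | h
          · exact ⟨y, hC.1, h, by simpa using hes⟩
          · have hpos : 0 < dist c y := by linarith
            have ht : 0 ≤ 1 - e / dist c y := by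
              rw [sub_nonneg, div_le_one hpos]; exact h.le
            refine ⟨y + (1 - e / dist c y) • (c - y), aux_cone hC hc ht, ?_, ?_⟩
            · have : c - (y + (1 - e / dist c y) • (c - y)) = (e / dist c y) • (c - y) := by
                module
              rw [dist_eq_norm c (y + _), this, norm_smul, ← dist_eq_norm c y, Real.norm_eq_abs,
                abs_of_nonneg (by apply div_nonneg <;> linarith), div_mul_cancel₀ _ hpos.ne']
            · have : dist (y + (1 - e / dist c y) • (c - y)) y = dist c y - e := by
                rw [dist_eq_norm (y + _), add_sub_cancel_left, norm_smul, ← dist_eq_norm c y,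
                  Real.norm_eq_abs, abs_of_nonneg ht, sub_mul, div_mul_cancel₀ _ hpos.ne', one_mul]
              rw [this]; linarith
        have hc'b : c' ∈ C ∩ closedBall y s := ⟨hc', mem_closedBall.2 (by linarith)⟩
        obtain ⟨p, hp, hpd⟩ := (Metric.infDist_lt_iff hSne).1 ((h1 c' hc'b).trans_lt he)
        have hpb : p ∈ S ∩ closedBall y s := ⟨hp, mem_closedBall.2 (by
          have := dist_triangle p c' y
          rw [dist_comm p c'] at this
          linarith)⟩
        have := Metric.infDist_le_dist_of_mem (x := c) hpb
        have := dist_triangle c c' p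
        linarith
      refine le_of_forall_pos_le_add fun δ hδ => ?_
      have h3 : ε < min s (ε + δ / 2) := lt_min hse (by linarith)
      have := key _ h3 (min_le_left _ _)
      have := min_le_right s (ε + δ / 2)
      linarith
  · rintro p hp
    refine le_of_forall_pos_le_add fun δ hδ => ?_
    have h3 : Metric.infDist p C < ε + δ / 2 := (h2 p hp).trans_lt (by linarith)
    obtain ⟨c, hc, hd⟩ := (Metric.infDist_lt_iff ⟨y, hC.1⟩).1 h3
    have hps := mem_closedBall.1 hp.2
    obtain ⟨c', hc', hd'⟩ : ∃ c' ∈ C ∩ closedBall y s, dist c c' ≤ dist p c := by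
      rcases le_or_gt (dist c y) s with h | h
      · exact ⟨c, ⟨hc, h⟩, by simp⟩
      · have hpos : 0 < dist c y := by linarith
        have ht : 0 ≤ s / dist c y := by positivity
        refine ⟨y + (s / dist c y) • (c - y), ⟨aux_cone hC hc ht, ?_⟩, ?_⟩
        · rw [mem_closedBall, dist_eq_norm (y + _), add_sub_cancel_left, norm_smul,
            ← dist_eq_norm c y, Real.norm_eq_abs, abs_of_nonneg ht, div_mul_cancel₀ _ hpos.ne']
        · have h4 : c - (y + (s / dist c y) • (c - y)) = (1 - s / dist c y) • (c - y) := by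
            module
          have h5 : 0 ≤ 1 - s / dist c y := by
            rw [sub_nonneg, div_le_one hpos]; exact h.le
          rw [dist_eq_norm c (y + _), h4, norm_smul, ← dist_eq_norm c y, Real.norm_eq_abs,
            abs_of_nonneg h5, sub_mul, div_mul_cancel₀ _ hpos.ne', one_mul]
          have := dist_triangle c p y
          rw [dist_comm c p] at this
          linarith
    have := Metric.infDist_le_dist_of_mem (x := p) hc'
    have := dist_triangle p c c'
    linarith

/-- Lemma 2.4 / `ConeG2`: localization of the relative Hausdorff distance
to a cone at a smaller ball. -/
theorem cone_hausdorff_localization {n : ℕ} (y x : E n) (C S : Set (E n))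
    (hC : IsConeAt y C) (r s : ℝ) (hr : 0 < r) (hs : 0 < s)
    (hsub : closedBall y s ⊆ closedBall x r) (hne : (S ∩ closedBall y s).Nonempty) :
    Dxr y s C S ≤ 2 * (r / s) * Dtxr x r C S ∧
    Dxr y s C S ≤ 2 * (r / s) * Dxr x r C S := by
  have hyb : y ∈ closedBall y s := mem_closedBall_self hs.le
  have hSne : S.Nonempty := hne.mono inter_subset_left
  have hCne : C.Nonempty := ⟨y, hC.1⟩
  have hCr : (C ∩ closedBall x r).Nonempty := ⟨y, hC.1, hsub hyb⟩
  have hSr : (S ∩ closedBall x r).Nonempty := hne.mono (inter_subset_inter_right _ hsub)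
  have first : Dxr y s C S ≤ 2 * (r / s) * Dtxr x r C S := by
    set ε := max (setD (C ∩ closedBall x r) S) (setD (S ∩ closedBall x r) C) with hεdef
    have hε : 0 ≤ ε := le_max_of_le_left (aux_setD_nonneg _ _)
    have hDt : Dtxr x r C S = (1 / r) * ε := by
      unfold Dtxr dtxr
      rw [hεdef, mul_max_of_nonneg _ _ (by positivity)]
    obtain ⟨m1, m2⟩ := aux_main y C S hC s ε hs hε hne
      (fun c hc => (aux_le_setD hr inter_subset_right hSne
        (⟨hc.1, hsub hc.2⟩ : c ∈ C ∩ closedBall x r)).trans (le_max_left _ _))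
      (fun p hp => (aux_le_setD hr inter_subset_right hCne
        (⟨hp.1, hsub hp.2⟩ : p ∈ S ∩ closedBall x r)).trans (le_max_right _ _))
    have hR : 2 * (r / s) * Dtxr x r C S = (1 / s) * (2 * ε) := by
      rw [hDt]; field_simp
    rw [hR]
    have hs' : 0 ≤ 1 / s := by positivity
    exact max_le (mul_le_mul_of_nonneg_left (aux_setD_le (by positivity) m1) hs')
      (mul_le_mul_of_nonneg_left (aux_setD_le (by positivity) m2) hs')
  refine ⟨first, first.trans ?_⟩
  have hr' : 0 ≤ 1 / r := by positivity
  refine mul_le_mul_of_nonneg_left (max_le_max ?_ ?_) (by positivity)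
  · exact mul_le_mul_of_nonneg_left (aux_setD_le (aux_setD_nonneg _ _) fun a ha =>
      (Metric.infDist_le_infDist_of_subset inter_subset_left hSr).trans
        (aux_le_setD hr inter_subset_right hSr ha)) hr'
  · exact mul_le_mul_of_nonneg_left (aux_setD_le (aux_setD_nonneg _ _) fun a ha =>
      (Metric.infDist_le_infDist_of_subset inter_subset_left hCr).trans
        (aux_le_setD hr inter_subset_right hCr ha)) hr'
end
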